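/- arXiv:1909.02324 — 2 statements merged into one kernel-verified Lean document; each statement's English description precedes it below -/
import Mathlib

section
/- Let F be an oriented, uniform quasi-geodesic foliation of the universal cover M̃ of a compact manifold of negative curvature. Then the positive and negative endpoint maps, considered as functions on the leaf space of F (with the topology of uniform convergence of leaves on compact sets) with values in ∂∞M̃, are continuous. -/
/-!
STATEMENT 4: Continuity of the endpoint maps for an oriented uniform quasi-geodesic
foliation of the universal cover of a compact negatively curved manifold (Lemma 2.4).

`M̃` is modelled as a proper geodesic `δ`-hyperbolic space with a cocompact deck action
and visual boundary `∂∞ M̃ = Sⁿ` given by geodesic-line data `line` (see the other files).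
A uniform quasi-geodesic foliation is given by a family `F` of (arclength-type)
parametrized curves `ℝ → M̃`, all `(c,k)`-quasi-geodesics, whose images partition `M̃`
(orientations are carried by the parametrizations).  The leaf space carries the topology
of uniform convergence on compact sets, modelled by the space `UniformOnFun ℝ M̃ 𝔖` with
`𝔖` the compact subsets of `ℝ`.  The forward endpoint of a quasi-geodesic is the boundary
point whose geodesic ray it fellow-travels; the backward endpoint is the forward endpoint
of the time-reversed curve.  The statement: the positive and negative endpoint maps are
continuous on `F`.
-/

open Metric Topology Filter Set

noncomputable section

/-- The `n`-dimensional sphere, realized as the unit sphere of `ℝ^{n+1}`. -/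
abbrev Sph (n : ℕ) : Type := ↥(Metric.sphere (0 : EuclideanSpace ℝ (Fin (n+1))) 1)

/-- The Gromov product of `x` and `y` based at `o`. -/
def gromovProd {X : Type*} [MetricSpace X] (o x y : X) : ℝ :=
  (dist o x + dist o y - dist x y) / 2

/-- Gromov `δ`-hyperbolicity (four point condition). -/
def IsDeltaHyperbolic (X : Type*) [MetricSpace X] (δ : ℝ) : Prop :=
  ∀ o x y z : X, min (gromovProd o x y) (gromovProd o y z) - δ ≤ gromovProd o x z

/-- A geodesic metric space: any two points are joined by an isometrically embedded segment. -/
def IsGeodesicSpace (X : Type*) [MetricSpace X] : Prop :=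
  ∀ x y : X, ∃ c : ℝ → X, c 0 = x ∧ c (dist x y) = y ∧
    ∀ s ∈ Set.Icc 0 (dist x y), ∀ t ∈ Set.Icc 0 (dist x y), dist (c s) (c t) = |s - t|

/-- A map `Γ → C(X,X)` is a representation (an element of `Hom(Γ, Homeo(X))`; for a
compact Hausdorff `X` each `ρ γ` is automatically a homeomorphism, with inverse `ρ γ⁻¹`). -/
def IsRep {Γ X : Type*} [Group Γ] [TopologicalSpace X] (ρ : Γ → C(X, X)) : Prop :=
  ρ 1 = ContinuousMap.id X ∧ ∀ a b : Γ, ρ (a * b) = (ρ a).comp (ρ b)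

/-- The data of the universal cover of a compact negatively curved `(n+1)`-manifold
together with its deck group action and visual boundary `Sⁿ`:
a proper geodesic `δ`-hyperbolic topological manifold with a free, properly discontinuous,
cocompact action of `Γ` by isometries; `line x ξ` is the unit-speed geodesic line through `x`
with forward endpoint `ξ ∈ ∂∞ M̃ = Sⁿ`, and the boundary action `ρ₀` is the extension of the
deck action, characterized by equivariance of geodesics. -/
structure NegCurvedSetup (n : ℕ) (Mt : Type)
    [MetricSpace Mt] [ChartedSpace (EuclideanSpace ℝ (Fin (n+1))) Mt]
    (Γ : Type) [Group Γ] (deck : Γ →* (Mt ≃ᵢ Mt))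
    (line : Mt → Sph n → ℝ → Mt) (ρ₀ : Γ → C(Sph n, Sph n)) : Prop where
  proper : ProperSpace Mt
  geodesic : IsGeodesicSpace Mt
  hyp : ∃ δ : ℝ, IsDeltaHyperbolic Mt δ
  free : ∀ (γ : Γ) (x : Mt), deck γ x = x → γ = 1
  properlyDisc : ∀ K : Set Mt, IsCompact K → {γ : Γ | ((deck γ '' K) ∩ K).Nonempty}.Finite
  cocompact : ∃ K : Set Mt, IsCompact K ∧ ∀ x : Mt, ∃ γ : Γ, deck γ x ∈ K
  line_zero : ∀ x ξ, line x ξ 0 = x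
  line_isom : ∀ x ξ s t, dist (line x ξ s) (line x ξ t) = |s - t|
  line_cont : Continuous fun p : Mt × Sph n × ℝ => line p.1 p.2.1 p.2.2
  /-- geodesics with the same forward endpoint fellow-travel -/
  line_fwd_bounded : ∀ x y ξ, ∃ B : ℝ, ∀ t : ℝ, 0 ≤ t → dist (line x ξ t) (line y ξ t) ≤ B
  /-- distinct boundary points give divergent rays -/
  line_fwd_distinct : ∀ x y ξ η,
    (∃ B : ℝ, ∀ t : ℝ, 0 ≤ t → dist (line x ξ t) (line y η t) ≤ B) → ξ = η
  /-- every geodesic line has a forward endpoint on the boundary sphere -/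
  line_exhaustive : ∀ c : ℝ → Mt, (∀ s t, dist (c s) (c t) = |s - t|) → ∃ ξ, c = line (c 0) ξ
  /-- uniqueness of the geodesic through a point with given forward endpoint -/
  line_unique : ∀ x ξ (c : ℝ → Mt), c 0 = x → (∀ s t, dist (c s) (c t) = |s - t|) →
    (∃ B : ℝ, ∀ t : ℝ, 0 ≤ t → dist (c t) (line x ξ t) ≤ B) → c = line x ξ
  isRep : IsRep ρ₀
  /-- `ρ₀` is the boundary action: it is the equivariant extension of the deck action -/
  equivariant : ∀ γ x ξ t, deck γ (line x ξ t) = line (deck γ x) (ρ₀ γ ξ) t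


/-- `α` is a global `(c,k)`-quasi-geodesic. -/
def IsQuasiGeodesic {X : Type*} [MetricSpace X] (c k : ℝ) (α : ℝ → X) : Prop :=
  ∀ s t : ℝ, (1 / k) * dist (α s) (α t) - c ≤ |s - t| ∧ |s - t| ≤ k * dist (α s) (α t) + c

/-- `ξ` is the forward endpoint of the curve `α`: the ray from `α 0` to `ξ` and the forward
part of `α` are at bounded Hausdorff distance from each other. -/
def FwdEndpoint {n : ℕ} {Mt : Type} [MetricSpace Mt]
    (line : Mt → Sph n → ℝ → Mt) (α : ℝ → Mt) (ξ : Sph n) : Prop :=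
  ∃ B : ℝ, (∀ t : ℝ, 0 ≤ t → ∃ s : ℝ, 0 ≤ s ∧ dist (α t) (line (α 0) ξ s) ≤ B) ∧
    (∀ s : ℝ, 0 ≤ s → ∃ t : ℝ, 0 ≤ t ∧ dist (α t) (line (α 0) ξ s) ≤ B)

/-- `ξ` is the backward (negative) endpoint of `α`. -/
def BwdEndpoint {n : ℕ} {Mt : Type} [MetricSpace Mt]
    (line : Mt → Sph n → ℝ → Mt) (α : ℝ → Mt) (ξ : Sph n) : Prop :=
  FwdEndpoint line (fun t => α (-t)) ξ

lemma IsDeltaHyperbolic.nonneg {X : Type*} [MetricSpace X] {δ : ℝ} (h : IsDeltaHyperbolic X δ)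
    (x : X) : 0 ≤ δ := by
  have := h x x x x
  simp only [min_self] at this
  linarith

/-- In a hyperbolic space, a path whose unit-time steps have Gromov product at least `m` has
Gromov product at least `m - N δ` over time `2 ^ N`. -/
lemma IsDeltaHyperbolic.le_gromovProd_of_abs_sub_le_two_pow {X : Type*} [MetricSpace X] {δ : ℝ}
    (h : IsDeltaHyperbolic X δ) {α : ℝ → X} {o : X} {m : ℝ}
    (hstep : ∀ a b : ℝ, 0 ≤ a → 0 ≤ b → |a - b| ≤ 1 → m ≤ gromovProd o (α a) (α b)) (N : ℕ) :
    ∀ a b : ℝ, 0 ≤ a → 0 ≤ b → |a - b| ≤ 2 ^ N → m - N * δ ≤ gromovProd o (α a) (α b) := by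
  induction N with
  | zero =>
    intro a b ha hb hab
    simpa using hstep a b ha hb (by simpa using hab)
  | succ N ih =>
    intro a b ha hb hab
    have hmid : |a - b| / 2 ≤ 2 ^ N := by rw [pow_succ] at hab; linarith
    have h₁ := ih a ((a + b) / 2) ha (by positivity) (by
      rwa [show a - (a + b) / 2 = (a - b) / 2 by ring, abs_div, abs_two])
    have h₂ := ih ((a + b) / 2) b (by positivity) hb (by
      rwa [show (a + b) / 2 - b = (a - b) / 2 by ring, abs_div, abs_two])
    have := le_min h₁ h₂
    have := h o (α a) (α ((a + b) / 2)) (α b)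
    push_cast
    linarith

/-- Exponentials beat linear functions: the real-variable form used in the Morse lemma. -/
lemma exists_forall_lt_exists_two_pow (δ a b C : ℝ) (hδ : 0 ≤ δ) (ha : 0 ≤ a) :
    ∃ D₀ : ℝ, 0 ≤ D₀ ∧ ∀ D : ℝ, D₀ < D → ∃ N : ℕ, a * D + b ≤ 2 ^ N ∧ C + N * δ < D := by
  have hlim : Tendsto (fun N : ℕ => (a * (δ + 1) * N + (a * (δ + 1 + |C|) + |b|)) / (2 : ℝ) ^ N)
      atTop (𝓝 0) := by
    have h₁ := (tendsto_pow_const_div_const_pow_of_one_lt 1 (one_lt_two (α := ℝ))).const_mul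
      (a * (δ + 1))
    have h₂ := (tendsto_pow_const_div_const_pow_of_one_lt 0 (one_lt_two (α := ℝ))).const_mul
      (a * (δ + 1 + |C|) + |b|)
    have h₃ := h₁.add h₂
    simp only [mul_zero, add_zero] at h₃
    refine h₃.congr fun N => ?_
    simp only [pow_one, pow_zero]
    ring
  obtain ⟨N₀, hN₀⟩ := eventually_atTop.1 (hlim.eventually (gt_mem_nhds zero_lt_one))
  refine ⟨|C| + (δ + 1) * (N₀ + 1), by positivity, fun D hD => ?_⟩
  have hδ' : 0 < δ + 1 := by linarith
  have hC := le_abs_self C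
  have hDC : (N₀ + 1 : ℝ) < (D - |C|) / (δ + 1) := by
    rw [lt_div_iff₀ hδ']; linarith
  have hpos : 0 ≤ (D - |C|) / (δ + 1) := le_trans (by positivity) hDC.le
  have hle := Nat.floor_le hpos
  have hlt := Nat.lt_floor_add_one ((D - |C|) / (δ + 1))
  set N := ⌊(D - |C|) / (δ + 1)⌋₊
  have hN : N₀ ≤ N := by
    have : (N₀ : ℝ) < N := by linarith
    exact_mod_cast this.le
  have hNpos : (0 : ℝ) < N := by
    have : (0 : ℝ) ≤ N₀ := by positivity
    linarith
  rw [le_div_iff₀ hδ'] at hle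
  rw [div_lt_iff₀ hδ'] at hlt
  refine ⟨N, ?_, by nlinarith⟩
  have := hN₀ N hN
  rw [div_lt_one (by positivity)] at this
  have := mul_le_mul_of_nonneg_left hlt.le ha
  have := le_abs_self b
  nlinarith

lemma IsQuasiGeodesic.dist_le {X : Type*} [MetricSpace X] {c k : ℝ} {α : ℝ → X}
    (h : IsQuasiGeodesic c k α) (hk : 1 ≤ k) (s t : ℝ) :
    dist (α s) (α t) ≤ k * (|s - t| + c) := by
  have h₁ := (h s t).1
  rw [one_div, inv_mul_eq_div, sub_le_iff_le_add, div_le_iff₀ (by linarith)] at h₁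
  linarith

/-- If a geodesic ray `l` starting on a quasi-geodesic `α` is in some bounded neighbourhood of
`α`, then it is in a neighbourhood whose radius depends only on the constants of hyperbolicity
and quasi-geodesicity. -/
lemma exists_uniform_neighbourhood_of_quasiGeodesic {X : Type*} [MetricSpace X] {δ c k : ℝ}
    (h : IsDeltaHyperbolic X δ) (hδ : 0 ≤ δ) (hc : 0 ≤ c) (hk : 1 ≤ k) :
    ∃ D₀ : ℝ, ∀ α l : ℝ → X, IsQuasiGeodesic c k α → (∀ s t, dist (l s) (l t) = |s - t|) →
      l 0 = α 0 → (∃ B : ℝ, ∀ s : ℝ, 0 ≤ s → ∃ t : ℝ, 0 ≤ t ∧ dist (α t) (l s) ≤ B) →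
      ∀ s : ℝ, 0 ≤ s → ∃ t : ℝ, 0 ≤ t ∧ dist (α t) (l s) ≤ D₀ := by
  obtain ⟨D₀, hD₀, hN⟩ := exists_forall_lt_exists_two_pow δ (k * 6) c
    (1 + k * (1 + c) / 2 + 2 * δ) hδ (by linarith)
  refine ⟨D₀, fun α l hα hl hl0 ⟨B, hB⟩ => ?_⟩
  have improve : ∀ D : ℝ, D₀ < D →
      (∀ s : ℝ, 0 ≤ s → ∃ t : ℝ, 0 ≤ t ∧ dist (α t) (l s) ≤ D) →
      ∀ s : ℝ, 0 ≤ s → ∃ t : ℝ, 0 ≤ t ∧ dist (α t) (l s) ≤ D - 1 := by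
    intro D hD hP s hs
    by_contra! hfar
    obtain ⟨N, hN₁, hN₂⟩ := hN D hD
    obtain ⟨t₂, ht₂, hd₂⟩ := hP (s + 2 * D) (by linarith)
    have hfar' : ∀ t : ℝ, 0 ≤ t → D - 1 < dist (l s) (α t) := fun t ht => by
      rw [dist_comm]; exact hfar t ht
    obtain ⟨s₁, t₁, hs₁s, hs₁D, ht₁, hd₁, hg₁⟩ : ∃ s₁ t₁ : ℝ, s₁ ≤ s ∧ s - 2 * D ≤ s₁ ∧ 0 ≤ t₁ ∧
        dist (α t₁) (l s₁) ≤ D ∧ D - 1 ≤ gromovProd (l s) (l s₁) (α t₁) := by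
      rcases le_total (s - 2 * D) 0 with hsD | hsD
      · refine ⟨0, 0, hs, hsD, le_rfl, by rw [hl0, dist_self]; linarith, ?_⟩
        have := hfar' 0 le_rfl
        rw [gromovProd, hl0, dist_self]
        linarith
      · obtain ⟨t₁, ht₁, hd₁⟩ := hP (s - 2 * D) hsD
        refine ⟨s - 2 * D, t₁, by linarith, le_rfl, ht₁, hd₁, ?_⟩
        have := hfar' t₁ ht₁
        rw [dist_comm] at hd₁
        rw [gromovProd, hl, abs_of_nonneg (by linarith)]
        linarith
    have hg₂ : D - 1 ≤ gromovProd (l s) (α t₂) (l (s + 2 * D)) := by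
      have := hfar' t₂ ht₂
      rw [gromovProd, hl s, abs_of_nonpos (by linarith)]
      linarith
    have hg : gromovProd (l s) (l s₁) (l (s + 2 * D)) = 0 := by
      rw [gromovProd, hl, hl, hl, abs_of_nonneg (by linarith), abs_of_nonpos (by linarith),
        abs_of_nonpos (by linarith)]
      ring
    have hlen : |t₁ - t₂| ≤ 2 ^ N := by
      have hl₁₂ : dist (l s₁) (l (s + 2 * D)) ≤ 4 * D := by
        rw [hl, abs_of_nonpos (by linarith)]; linarith
      have htri := dist_triangle4 (α t₁) (l s₁) (l (s + 2 * D)) (α t₂)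
      rw [dist_comm (l (s + 2 * D))] at htri
      have : k * dist (α t₁) (α t₂) ≤ k * (6 * D) :=
        mul_le_mul_of_nonneg_left (by linarith) (by linarith)
      have := (hα t₁ t₂).2
      linarith
    have hpath := h.le_gromovProd_of_abs_sub_le_two_pow (α := α) (o := l s)
      (m := D - 1 - k * (1 + c) / 2) (fun a b ha hb hab => by
        have := hfar' a ha
        have := hfar' b hb
        have := hα.dist_le hk a b
        have : k * (|a - b| + c) ≤ k * (1 + c) :=
          mul_le_mul_of_nonneg_left (by linarith) (by linarith)
        rw [gromovProd]
        linarith) N t₁ t₂ ht₁ ht₂ hlen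
    have h₁ := h (l s) (l s₁) (α t₁) (l (s + 2 * D))
    have h₂ := h (l s) (α t₁) (α t₂) (l (s + 2 * D))
    have hNδ : 0 ≤ N * δ := by positivity
    have hkc : 0 ≤ k * (1 + c) := by positivity
    have h₃ := le_min hpath (le_trans (by linarith) hg₂)
    have h₄ := le_min (le_trans (by linarith) hg₁)
      (show D - 1 - k * (1 + c) / 2 - N * δ - δ ≤
        gromovProd (l s) (α t₁) (l (s + 2 * D)) by linarith)
    linarith
  have descend : ∀ j : ℕ, (∀ s : ℝ, 0 ≤ s → ∃ t : ℝ, 0 ≤ t ∧ dist (α t) (l s) ≤ D₀ + j) →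
      ∀ s : ℝ, 0 ≤ s → ∃ t : ℝ, 0 ≤ t ∧ dist (α t) (l s) ≤ D₀ := by
    intro j
    induction j with
    | zero => simp
    | succ j ih =>
      intro hj
      have hlt : D₀ < D₀ + (j + 1 : ℕ) := by
        push_cast
        have : (0 : ℝ) ≤ j := by positivity
        linarith
      refine ih fun s hs => ?_
      obtain ⟨t, ht, hd⟩ := improve _ hlt hj s hs
      exact ⟨t, ht, hd.trans (by push_cast; linarith)⟩
  refine descend ⌈B⌉₊ fun s hs => ?_
  obtain ⟨t, ht, hd⟩ := hB s hs
  exact ⟨t, ht, by linarith [Nat.le_ceil B]⟩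

lemma IsQuasiGeodesic.comp_neg {X : Type*} [MetricSpace X] {c k : ℝ} {α : ℝ → X}
    (h : IsQuasiGeodesic c k α) : IsQuasiGeodesic c k fun t => α (-t) := fun s t => by
  have := h (-s) (-t)
  rwa [show -s - -t = -(s - t) by ring, abs_neg] at this

/-- A boundary point whose ray stays close to `α` is the forward endpoint of `α`. -/
lemma FwdEndpoint.eq_of_bounded {n : ℕ} {Mt : Type} [MetricSpace Mt]
    {line : Mt → Sph n → ℝ → Mt}
    (line_zero : ∀ x ξ, line x ξ 0 = x)
    (line_isom : ∀ x ξ s t, dist (line x ξ s) (line x ξ t) = |s - t|)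
    (line_fwd_distinct : ∀ x y ξ η,
      (∃ B : ℝ, ∀ t : ℝ, 0 ≤ t → dist (line x ξ t) (line y η t) ≤ B) → ξ = η)
    {α : ℝ → Mt} {ξ η : Sph n} (hξ : FwdEndpoint line α ξ) {D : ℝ}
    (hη : ∀ s : ℝ, 0 ≤ s → ∃ t : ℝ, 0 ≤ t ∧ dist (α t) (line (α 0) η s) ≤ D) : η = ξ := by
  obtain ⟨B, hB, -⟩ := hξ
  refine line_fwd_distinct (α 0) (α 0) η ξ ⟨2 * (D + B), fun s hs => ?_⟩
  obtain ⟨t, ht, hd⟩ := hη s hs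
  obtain ⟨s', hs', hd'⟩ := hB t ht
  have hclose : dist (line (α 0) η s) (line (α 0) ξ s') ≤ D + B :=
    (dist_triangle_left _ _ (α t)).trans (add_le_add hd hd')
  have hη0 : dist (line (α 0) η s) (α 0) = s := by
    have := line_isom (α 0) η s 0
    rwa [line_zero, sub_zero, abs_of_nonneg hs] at this
  have hξ0 : dist (line (α 0) ξ s') (α 0) = s' := by
    have := line_isom (α 0) ξ s' 0
    rwa [line_zero, sub_zero, abs_of_nonneg hs'] at this
  have hss : |s' - s| ≤ D + B := by
    have := abs_dist_sub_le (line (α 0) ξ s') (line (α 0) η s) (α 0)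
    rw [hη0, hξ0, dist_comm] at this
    exact this.trans hclose
  have := dist_triangle (line (α 0) η s) (line (α 0) ξ s') (line (α 0) ξ s)
  rw [line_isom] at this
  linarith

/-- For a locally uniformly varying family of uniform quasi-geodesics, the forward endpoint
varies continuously. -/
lemma continuous_of_fwdEndpoint {n : ℕ} {Mt : Type} [MetricSpace Mt]
    {line : Mt → Sph n → ℝ → Mt} {δ c k : ℝ} (hyp : IsDeltaHyperbolic Mt δ)
    (line_zero : ∀ x ξ, line x ξ 0 = x)
    (line_isom : ∀ x ξ s t, dist (line x ξ s) (line x ξ t) = |s - t|)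
    (line_cont : Continuous fun p : Mt × Sph n × ℝ => line p.1 p.2.1 p.2.2)
    (line_fwd_distinct : ∀ x y ξ η,
      (∃ B : ℝ, ∀ t : ℝ, 0 ≤ t → dist (line x ξ t) (line y η t) ≤ B) → ξ = η)
    (hc : 0 ≤ c) (hk : 1 ≤ k) {ι : Type*} [TopologicalSpace ι] {φ : ι → ℝ → Mt} {e : ι → Sph n}
    (hφ : ∀ i, IsQuasiGeodesic c k (φ i)) (he : ∀ i, FwdEndpoint line (φ i) (e i))
    (hunif : ∀ i T, TendstoUniformlyOn φ (φ i) (𝓝 i) (Icc 0 T)) : Continuous e := by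
  rw [continuous_iff_ultrafilter]
  intro i g hg
  obtain ⟨D₀, hD₀⟩ :=
    exists_uniform_neighbourhood_of_quasiGeodesic hyp (hyp.nonneg (φ i 0)) hc hk
  obtain ⟨η, -, hη⟩ := isCompact_univ.ultrafilter_le_nhds (g.map e) (by simp)
  have hη' : Tendsto e g (𝓝 η) := hη
  suffices η = e i by rwa [← this]
  have h0 : Tendsto (fun j => φ j 0) g (𝓝 (φ i 0)) :=
    ((hunif i 0).tendsto_at (left_mem_Icc.2 le_rfl)).mono_left hg
  refine (he i).eq_of_bounded line_zero line_isom line_fwd_distinct (D := D₀ + 2) fun s hs => ?_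
  have hline : Tendsto (fun j => line (φ j 0) (e j) s) g (𝓝 (line (φ i 0) η s)) :=
    (line_cont.tendsto (φ i 0, η, s)).comp
      (h0.prodMk_nhds (hη'.prodMk_nhds tendsto_const_nhds))
  have h₁ := Metric.tendsto_nhds.1 hline 1 one_pos
  have h₂ := hg (Metric.tendstoUniformlyOn_iff.1 (hunif i (k * (D₀ + s) + c)) 1 one_pos)
  obtain ⟨j, hj₁, hj₂⟩ := (h₁.and h₂).exists
  obtain ⟨B, -, hB⟩ := he j
  obtain ⟨t, ht, hd⟩ := hD₀ (φ j) (line (φ j 0) (e j)) (hφ j) (line_isom _ _)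
    (line_zero _ _) ⟨B, hB⟩ s hs
  have htT : t ≤ k * (D₀ + s) + c := by
    have hls : dist (line (φ j 0) (e j) s) (φ j 0) = s := by
      have := line_isom (φ j 0) (e j) s 0
      rwa [line_zero, sub_zero, abs_of_nonneg hs] at this
    have := dist_triangle (φ j t) (line (φ j 0) (e j) s) (φ j 0)
    have hle : k * dist (φ j t) (φ j 0) ≤ k * (D₀ + s) :=
      mul_le_mul_of_nonneg_left (by linarith) (by linarith)
    have hqg := (hφ j t 0).2
    rw [sub_zero, abs_of_nonneg ht] at hqg
    linarith
  refine ⟨t, ht, ?_⟩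
  have := hj₂ t ⟨ht, htT⟩
  have := dist_triangle4 (φ i t) (φ j t) (line (φ j 0) (e j) s) (line (φ i 0) η s)
  linarith

/-- **Continuity of endpoint maps** (Lemma 2.4).  Let `F` (a set of parametrized curves,
with the topology of uniform convergence on compact sets) be an oriented uniform
quasi-geodesic foliation of `M̃`: each curve is a `(c,k)`-quasi-geodesic, the images cover
`M̃` and two curves with intersecting images have equal images.  Then the positive and
negative endpoint maps `e⁺, e⁻ : F → ∂∞M̃` are continuous. -/
theorem endpoint_maps_continuous_on_leaf_space
    (n : ℕ) (Mt : Type) [MetricSpace Mt] [ChartedSpace (EuclideanSpace ℝ (Fin (n+1))) Mt]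
    (Γ : Type) [Group Γ] (deck : Γ →* (Mt ≃ᵢ Mt))
    (line : Mt → Sph n → ℝ → Mt) (ρ₀ : Γ → C(Sph n, Sph n))
    (H : NegCurvedSetup n Mt Γ deck line ρ₀)
    (c k : ℝ) (hc : 0 ≤ c) (hk : 1 ≤ k)
    (F : Set (UniformOnFun ℝ Mt {K : Set ℝ | IsCompact K}))
    (hcont : ∀ α ∈ F, Continuous (UniformOnFun.toFun _ α))
    (hQG : ∀ α ∈ F, IsQuasiGeodesic c k (UniformOnFun.toFun _ α))
    (hcover : ∀ x : Mt, ∃ α ∈ F, x ∈ Set.range (UniformOnFun.toFun _ α))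
    (hpartition : ∀ α ∈ F, ∀ β ∈ F,
      (Set.range (UniformOnFun.toFun _ α) ∩ Set.range (UniformOnFun.toFun _ β)).Nonempty →
      Set.range (UniformOnFun.toFun _ α) = Set.range (UniformOnFun.toFun _ β))
    (ePlus eMinus : ↥F → Sph n)
    (hPlus : ∀ α : ↥F, FwdEndpoint line (UniformOnFun.toFun _ α.1) (ePlus α))
    (hMinus : ∀ α : ↥F, BwdEndpoint line (UniformOnFun.toFun _ α.1) (eMinus α)) :
    Continuous ePlus ∧ Continuous eMinus := by
  obtain ⟨δ, hyp⟩ := H.hyp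
  have hunif : ∀ (α : F) (K : Set ℝ), IsCompact K →
      TendstoUniformlyOn (fun β : F => UniformOnFun.toFun _ β.1) (UniformOnFun.toFun _ α.1)
        (𝓝 α) K := fun α K hK =>
    UniformOnFun.tendsto_iff_tendstoUniformlyOn.1 (continuous_subtype_val.tendsto α) K hK
  refine ⟨continuous_of_fwdEndpoint hyp H.line_zero H.line_isom H.line_cont H.line_fwd_distinct
      hc hk (fun α => hQG α.1 α.2) hPlus fun α T => hunif α _ isCompact_Icc,
    continuous_of_fwdEndpoint hyp H.line_zero H.line_isom H.line_cont H.line_fwd_distinct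
      hc hk (fun α => (hQG α.1 α.2).comp_neg) hMinus fun α T => ?_⟩
  refine ((hunif α (Icc (-T) 0) isCompact_Icc).comp fun t : ℝ => -t).mono fun t ht => ?_
  exact ⟨neg_le_neg ht.2, neg_nonpos.2 ht.1⟩

end
end

section
/- Let Γ be a countable group and ρ: Γ → Diff¹₊(Sⁿ) an action by orientation-preserving C¹ diffeomorphisms of the n-sphere with a dense orbit Z. Then there exists an action ρ': Γ → Homeo₊(Sⁿ) and a surjective continuous map h: Sⁿ → Sⁿ such that the preimage under h of each point of Z is a closed n-disk, h is injective on the complement of h⁻¹(Z), and h ∘ ρ'(γ) = ρ(γ) ∘ h for all γ ∈ Γ. In particular ρ is a topological factor of ρ' via a map with contractible point preimages. -/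
/-!
STATEMENT 12: Equivariant blow-up of an orbit (Proposition 4.1).

Let `Γ` be a countable group and `ρ : Γ → Diff¹₊(Sⁿ)` an action by (orientation
preserving) `C¹` diffeomorphisms of the `n`-sphere with a dense orbit `Z = Γ·z`.
Then there is an action `ρ'` by homeomorphisms of `Sⁿ` and a surjective continuous
`h : Sⁿ → Sⁿ` with `h ∘ ρ'(γ) = ρ(γ) ∘ h`, such that the `h`-preimage of each point of
`Z` is a closed `n`-disk and `h` is injective on the complement of `h⁻¹(Z)`.

Modelling: `Sⁿ` is the unit sphere of `ℝ^{n+1}` with its standard smooth structure; an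
action by homeomorphisms is a multiplicative family of continuous self-maps (`IsRep`;
invertibility is automatic from the group law), and `C¹`-ness of `ρ γ` is
`ContMDiff (𝓡 (n+1)')... 1`.  (Orientation-preservation, which plays no role in the
blow-up construction, is not formalized: there is no notion of degree/orientation for
sphere homeomorphisms available.)  "Closed `n`-disk" means homeomorphic to the closed
unit ball of `ℝⁿ`.
-/

open Metric Topology Set
open scoped Manifold

noncomputable section

/-- The closed `n`-disk. -/
abbrev Disk (n : ℕ) : Type := ↥(Metric.closedBall (0 : EuclideanSpace ℝ (Fin n)) 1)

open Filter
open NormedSpace (normalize)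
open scoped InnerProductSpace

section Resolvent

variable {E : Type*} [NormedAddCommGroup E] {c : E → ℝ}

lemma tendsto_weight_nhdsNE (hc : Summable c) (x : E) : Tendsto c (𝓝[≠] x) (𝓝 0) :=
  hc.tendsto_cofinite_zero.mono_left (nhdsNE_le_cofinite x)

/-- The convex potential whose subdifferential at `x` is the closed ball of centre `drift c x` and
radius `c x`. -/
def potential (c : E → ℝ) (x : E) : ℝ := ∑' p, c p * ‖x - p‖

lemma summable_potential (hc0 : ∀ p, 0 ≤ c p) (hc : Summable c)
    (hc' : Summable fun p => c p * ‖p‖) (x : E) : Summable fun p => c p * ‖x - p‖ := by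
  refine Summable.of_nonneg_of_le (fun p => mul_nonneg (hc0 p) (norm_nonneg _)) (fun p => ?_)
    ((hc.mul_right ‖x‖).add hc')
  rw [← mul_add]
  exact mul_le_mul_of_nonneg_left (norm_sub_le _ _) (hc0 p)

lemma potential_nonneg (hc0 : ∀ p, 0 ≤ c p) (x : E) : 0 ≤ potential c x :=
  tsum_nonneg fun p => mul_nonneg (hc0 p) (norm_nonneg _)

lemma norm_normalize_le_one [NormedSpace ℝ E] (x : E) : ‖normalize x‖ ≤ 1 := by
  rcases eq_or_ne x 0 with rfl | hx
  · simp
  · exact (NormedSpace.norm_normalize hx).le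

lemma continuousAt_normalize [NormedSpace ℝ E] {x : E} (hx : x ≠ 0) :
    ContinuousAt (normalize : E → E) x := by
  have : ContinuousAt (fun y : E => ‖y‖⁻¹ • y) x :=
    (continuousAt_id.norm.inv₀ (norm_ne_zero_iff.2 hx)).smul continuousAt_id
  exact this

variable [InnerProductSpace ℝ E]

/-- The gradient of `x ↦ ∑ p, c p * ‖x - p‖`, where the terms that are not differentiable at `x`
are left out. -/
def drift (c : E → ℝ) (x : E) : E := ∑' p, c p • normalize (x - p)

lemma inner_normalize_self (x : E) : ⟪normalize x, x⟫_ℝ = ‖x‖ := by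
  rcases eq_or_ne x 0 with rfl | hx
  · simp
  · have : ‖x‖ ≠ 0 := norm_ne_zero_iff.2 hx
    rw [NormedSpace.normalize, real_inner_smul_left, real_inner_self_eq_norm_sq]
    field_simp

lemma norm_sub_sub_inner_normalize_nonneg (a b : E) :
    0 ≤ ‖b‖ - ‖a‖ - ⟪normalize a, b - a⟫_ℝ := by
  rw [inner_sub_right, inner_normalize_self]
  have h := real_inner_le_norm (normalize a) b
  nlinarith [norm_normalize_le_one a, norm_nonneg b]

lemma norm_smul_normalize_le (hc0 : ∀ p, 0 ≤ c p) (p x : E) : ‖c p • normalize x‖ ≤ c p := by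
  rw [norm_smul, Real.norm_of_nonneg (hc0 p)]
  exact mul_le_of_le_one_right (hc0 p) (norm_normalize_le_one x)

lemma norm_drift_le (hc0 : ∀ p, 0 ≤ c p) (hc : Summable c) (x : E) : ‖drift c x‖ ≤ ∑' p, c p :=
  tsum_of_norm_bounded hc.hasSum fun p => norm_smul_normalize_le hc0 p _

variable [CompleteSpace E]

lemma summable_drift (hc0 : ∀ p, 0 ≤ c p) (hc : Summable c) (x : E) :
    Summable fun p => c p • normalize (x - p) :=
  Summable.of_norm_bounded hc fun p => norm_smul_normalize_le hc0 p _

/-- Up to the jump `c x₀` in the direction of approach, the drift is continuous at `x₀`. -/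
lemma tendsto_drift_sub_jump (hc0 : ∀ p, 0 ≤ c p) (hc : Summable c) (x₀ : E) :
    Tendsto (fun x => drift c x - c x₀ • normalize (x - x₀)) (𝓝 x₀) (𝓝 (drift c x₀)) := by
  classical
  have key : ∀ x, drift c x - c x₀ • normalize (x - x₀) =
      ∑' p, if p = x₀ then 0 else c p • normalize (x - p) := by
    intro x
    rw [drift, (summable_drift hc0 hc x).tsum_eq_add_tsum_ite x₀]
    abel
  have key' : drift c x₀ = ∑' p, if p = x₀ then 0 else c p • normalize (x₀ - p) := by
    simpa using key x₀
  rw [key']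
  simp_rw [key]
  refine tendsto_tsum_of_dominated_convergence hc (fun p => ?_) (Eventually.of_forall fun x p => ?_)
  · by_cases hp : p = x₀
    · simp [hp]
    · simp only [hp, if_false]
      refine Tendsto.const_smul ?_ _
      have h : ContinuousAt (normalize : E → E) (x₀ - p) :=
        continuousAt_normalize (sub_ne_zero.2 (Ne.symm hp))
      exact h.tendsto.comp ((continuous_id.sub continuous_const).tendsto x₀)
  · by_cases hp : p = x₀
    · simp [hp, hc0]
    · simpa only [hp, if_false] using norm_smul_normalize_le hc0 p _

lemma potential_add_inner_le (hc0 : ∀ p, 0 ≤ c p) (hc : Summable c)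
    (hc' : Summable fun p => c p * ‖p‖) {x w : E} (hw : ‖w - drift c x‖ ≤ c x) (x' : E) :
    potential c x + ⟪w, x' - x⟫_ℝ ≤ potential c x' := by
  have hs : HasSum (fun p => c p * (‖x' - p‖ - ‖x - p‖ - ⟪normalize (x - p), x' - x⟫_ℝ))
      (potential c x' - potential c x - ⟪drift c x, x' - x⟫_ℝ) := by
    have h1 := (summable_potential hc0 hc hc' x').hasSum
    have h2 := (summable_potential hc0 hc hc' x).hasSum
    have h3 := ((summable_drift hc0 hc x).hasSum).mapL ((innerSL ℝ).flip (x' - x))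
    have hflip : ∀ v : E, (innerSL ℝ).flip (x' - x) v = ⟪v, x' - x⟫_ℝ := fun _ => rfl
    simp only [hflip, real_inner_smul_left] at h3
    simp only [mul_sub]
    exact (h1.sub h2).sub h3
  have hle := le_hasSum hs x fun p _ => mul_nonneg (hc0 p) (by
    simpa using norm_sub_sub_inner_normalize_nonneg (x - p) (x' - p))
  simp only [sub_self, norm_zero, sub_zero, NormedSpace.normalize_zero_eq_zero, inner_zero_left]
    at hle
  have h4 : ⟪w - drift c x, x' - x⟫_ℝ ≤ c x * ‖x' - x‖ :=
    (real_inner_le_norm _ _).trans (mul_le_mul_of_nonneg_right hw (norm_nonneg _))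
  rw [inner_sub_left] at h4
  linarith

lemma continuous_potential (hc0 : ∀ p, 0 ≤ c p) (hc : Summable c)
    (hc' : Summable fun p => c p * ‖p‖) : Continuous (potential c) := by
  have hC : 0 ≤ ∑' p, c p := tsum_nonneg hc0
  refine (LipschitzWith.of_le_add_mul ⟨_, hC⟩ fun x y => ?_).continuous
  have h1 := potential_add_inner_le hc0 hc hc' (x := x) (w := drift c x) (by simpa using hc0 x) y
  have h2 := abs_real_inner_le_norm (drift c x) (y - x)
  have h3 := mul_le_mul_of_nonneg_right (norm_drift_le hc0 hc x) (norm_nonneg (y - x))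
  have h4 := neg_abs_le ⟪drift c x, y - x⟫_ℝ
  rw [dist_comm, dist_eq_norm]
  show _ ≤ _ + (∑' p, c p) * _
  linarith

/-- `x ↦ closedBall (x + drift c x) (c x)` is a strongly monotone relation. -/
lemma norm_sub_le_of_mem_inflation (hc0 : ∀ p, 0 ≤ c p) (hc : Summable c)
    (hc' : Summable fun p => c p * ‖p‖) {x x' y y' : E} (h : ‖y - x - drift c x‖ ≤ c x)
    (h' : ‖y' - x' - drift c x'‖ ≤ c x') : ‖x - x'‖ ≤ ‖y - y'‖ := by
  have h1 := potential_add_inner_le hc0 hc hc' h x'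
  have h2 := potential_add_inner_le hc0 hc hc' h' x
  have h3 : ⟪y - y', x - x'⟫_ℝ = ⟪x - x', x - x'⟫_ℝ - ⟪y - x, x' - x⟫_ℝ - ⟪y' - x', x - x'⟫_ℝ := by
    simp only [inner_sub_left, inner_sub_right]
    ring
  rw [real_inner_self_eq_norm_sq] at h3
  have h4 := real_inner_le_norm (y - y') (x - x')
  by_contra! hlt
  nlinarith [norm_nonneg (y - y')]

lemma exists_mem_inflation [FiniteDimensional ℝ E] (hc0 : ∀ p, 0 ≤ c p) (hc : Summable c)
    (hc' : Summable fun p => c p * ‖p‖) (y : E) : ∃ x, ‖y - x - drift c x‖ ≤ c x := by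
  have hcont : Continuous fun x => ‖x - y‖ ^ 2 / 2 + potential c x :=
    (((continuous_id.sub continuous_const).norm.pow 2).div_const 2).add
      (continuous_potential hc0 hc hc')
  have hlim : Tendsto (fun x => ‖x - y‖ ^ 2 / 2 + potential c x) (cocompact E) atTop := by
    have h1 : Tendsto (fun x : E => ‖x - y‖) (cocompact E) atTop := by
      simpa only [dist_eq_norm] using tendsto_dist_right_cocompact_atTop y
    have h2 : Tendsto (fun x : E => ‖x - y‖ ^ 2 / 2) (cocompact E) atTop :=
      ((tendsto_pow_atTop two_ne_zero).comp h1).atTop_div_const two_pos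
    exact tendsto_atTop_mono (fun x => le_add_of_nonneg_right (potential_nonneg hc0 x)) h2
  obtain ⟨x, hx⟩ := hcont.exists_forall_le hlim
  refine ⟨x, ?_⟩
  have hdir : ∀ u : E, ⟪y - x - drift c x, u⟫_ℝ ≤ c x * ‖u‖ := by
    intro u
    have hpos : ∀ t : ℝ, 0 < t →
        0 ≤ ⟪x - y + (t / 2) • u + (drift c (x + t • u) - c x • normalize (x + t • u - x))
          + c x • normalize u, u⟫_ℝ := by
      intro t ht
      have h1 := hx (x + t • u)
      have h2 := potential_add_inner_le hc0 hc hc' (x := x + t • u) (w := drift c (x + t • u))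
        (by simpa using hc0 _) x
      have h3 : ‖x + t • u - y‖ ^ 2 = ‖x - y‖ ^ 2 + 2 * (t * ⟪x - y, u⟫_ℝ) + t ^ 2 * ⟪u, u⟫_ℝ := by
        rw [show x + t • u - y = (x - y) + t • u by abel, norm_add_sq_real, real_inner_smul_right,
          norm_smul, mul_pow, real_inner_self_eq_norm_sq]
        simp
      have h4 : x - (x + t • u) = -(t • u) := by abel
      rw [h4, inner_neg_right, real_inner_smul_right] at h2
      rw [add_sub_cancel_left, NormedSpace.normalize_smul_of_pos ht]
      simp only [h3] at h1
      rw [add_assoc, sub_add_cancel, inner_add_left, inner_add_left, real_inner_smul_left]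
      refine nonneg_of_mul_nonneg_right (a := t) ?_ ht
      nlinarith
    have hmove : Tendsto (fun t : ℝ => x + t • u) (𝓝[>] 0) (𝓝 x) := by
      have : Continuous fun t : ℝ => x + t • u := by fun_prop
      simpa using (this.tendsto 0).mono_left nhdsWithin_le_nhds
    have hhalf : Tendsto (fun t : ℝ => (t / 2) • u) (𝓝[>] 0) (𝓝 0) := by
      have : Continuous fun t : ℝ => (t / 2) • u := by fun_prop
      simpa using (this.tendsto 0).mono_left nhdsWithin_le_nhds
    have hl := (((tendsto_const_nhds (x := x - y)).add hhalf).add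
      ((tendsto_drift_sub_jump hc0 hc x).comp hmove)).add
      (tendsto_const_nhds (x := c x • normalize u))
    have h0 := ge_of_tendsto (hl.inner (tendsto_const_nhds (x := u)))
      (eventually_mem_nhdsWithin.mono fun t ht => hpos t ht)
    rw [add_zero, inner_add_left, real_inner_smul_left, inner_normalize_self] at h0
    have h5 : ⟪y - x - drift c x, u⟫_ℝ = - ⟪x - y + drift c x, u⟫_ℝ := by
      rw [← inner_neg_left]
      congr 1
      abel
    linarith
  have h := hdir (y - x - drift c x)
  rw [real_inner_self_eq_norm_sq] at h
  by_contra! hlt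
  nlinarith [hc0 x]

/-- The resolvent of the subdifferential of `potential c`: a continuous surjection of `E` which
collapses the closed ball of centre `x + drift c x` and radius `c x` to `x`. -/
lemma exists_resolvent [FiniteDimensional ℝ E] (hc0 : ∀ p, 0 ≤ c p) (hc : Summable c)
    (hc' : Summable fun p => c p * ‖p‖) :
    ∃ r : E → E, Continuous r ∧ (∀ x y, r y = x ↔ ‖y - x - drift c x‖ ≤ c x) ∧
      Tendsto r (cocompact E) (cocompact E) := by
  choose r hr using exists_mem_inflation hc0 hc hc'
  have hlip : LipschitzWith 1 r := LipschitzWith.of_dist_le_mul fun y y' => by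
    simpa [dist_eq_norm] using norm_sub_le_of_mem_inflation hc0 hc hc' (hr y) (hr y')
  refine ⟨r, hlip.continuous, fun x y => ⟨fun h => h ▸ hr y, fun h => ?_⟩, ?_⟩
  · have := norm_sub_le_of_mem_inflation hc0 hc hc' (hr y) h
    rw [sub_self, norm_zero, norm_le_zero_iff] at this
    exact sub_eq_zero.1 this
  · refine tendsto_cocompact_of_tendsto_dist_comp_atTop 0 ?_
    have hb : ∀ y, dist y 0 - 2 * ∑' p, c p ≤ dist (r y) 0 := by
      intro y
      have h1 := norm_drift_le hc0 hc (r y)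
      have h2 := hc.le_tsum (r y) fun p _ => hc0 p
      have h3 : ‖y‖ ≤ ‖r y‖ + ‖drift c (r y)‖ + ‖y - r y - drift c (r y)‖ := by
        calc ‖y‖ = ‖r y + drift c (r y) + (y - r y - drift c (r y))‖ := by congr 1; abel
          _ ≤ _ := norm_add₃_le
      simp only [dist_zero_right]
      linarith [hr y]
    exact tendsto_atTop_mono hb (tendsto_atTop_add_const_right _ _
      (tendsto_dist_right_cocompact_atTop 0))

end Resolvent

section Radial

variable {E : Type*} [NormedAddCommGroup E] [NormedSpace ℝ E]

/-- The action of a linear map on directions, coned off to an action on the unit ball. -/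
def radial (A : E →L[ℝ] E) (ξ : E) : E := ‖ξ‖ • normalize (A ξ)

lemma norm_radial_le (A : E →L[ℝ] E) (ξ : E) : ‖radial A ξ‖ ≤ ‖ξ‖ := by
  rw [radial, norm_smul, norm_norm]
  exact mul_le_of_le_one_right (norm_nonneg _) (norm_normalize_le_one _)

lemma radial_id (ξ : E) : radial (ContinuousLinearMap.id ℝ E) ξ = ξ :=
  NormedSpace.norm_smul_normalize ξ

lemma radial_comp (A : E →L[ℝ] E) {B : E →L[ℝ] E} (hB : Function.Injective B) (ξ : E) :
    radial (A.comp B) ξ = radial A (radial B ξ) := by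
  rcases eq_or_ne ξ 0 with rfl | hξ
  · simp [radial]
  have hBξ : B ξ ≠ 0 := fun h => hξ (hB (by rw [h, map_zero]))
  have h1 : ‖radial B ξ‖ = ‖ξ‖ := by
    rw [radial, norm_smul, norm_norm, NormedSpace.norm_normalize hBξ, mul_one]
  have h2 : A (radial B ξ) = (‖ξ‖ * ‖B ξ‖⁻¹) • A (B ξ) := by
    rw [radial, NormedSpace.normalize, smul_smul, map_smul]
  have h3 : 0 < ‖ξ‖ * ‖B ξ‖⁻¹ :=
    mul_pos (norm_pos_iff.2 hξ) (inv_pos.2 (norm_pos_iff.2 hBξ))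
  rw [radial, radial, h1, h2, NormedSpace.normalize_smul_of_pos h3, ContinuousLinearMap.comp_apply]

lemma continuous_radial {A : E →L[ℝ] E} (hA : Function.Injective A) : Continuous (radial A) := by
  refine continuous_iff_continuousAt.2 fun ξ => ?_
  rcases eq_or_ne ξ 0 with rfl | hξ
  · have h0 : radial A 0 = 0 := by simp [radial]
    rw [ContinuousAt, h0]
    exact squeeze_zero_norm (norm_radial_le A) (by simpa using (continuous_norm (E := E)).tendsto 0)
  · have hAξ : A ξ ≠ 0 := fun h => hξ (hA (by rw [h, map_zero]))
    exact tendsto_id.norm.smul ((continuousAt_normalize hAξ).tendsto.comp (A.continuous.tendsto ξ))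

/-- A differentiable map acts on directions of approach through its derivative. -/
lemma HasFDerivAt.tendsto_normalize_sub {β : Type*} {l : Filter β} {f : E → E} {A : E →L[ℝ] E}
    {x ξ : E} {g : β → E} (hf : HasFDerivAt f A x) (hg : Tendsto g l (𝓝 x))
    (hne : ∀ᶠ b in l, g b ≠ x) (hdir : Tendsto (fun b => normalize (g b - x)) l (𝓝 ξ))
    (hAξ : A ξ ≠ 0) :
    Tendsto (fun b => normalize (f (g b) - f x)) l (𝓝 (normalize (A ξ))) := by
  have h1 : Tendsto (fun b => ‖g b - x‖⁻¹ • (f (g b) - f x - A (g b - x))) l (𝓝 0) := by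
    rw [tendsto_zero_iff_norm_tendsto_zero]
    simpa [norm_smul, Function.comp_def] using (hasFDerivAt_iff_tendsto.1 hf).comp hg
  have h2 : Tendsto (fun b => ‖g b - x‖⁻¹ • (f (g b) - f x)) l (𝓝 (A ξ)) := by
    have h3 := h1.add ((A.continuous.tendsto ξ).comp hdir)
    rw [zero_add] at h3
    refine h3.congr fun b => ?_
    simp only [Function.comp_apply, NormedSpace.normalize]
    rw [map_smul, ← smul_add, sub_add_cancel]
  refine ((continuousAt_normalize hAξ).tendsto.comp h2).congr' (hne.mono fun b hb => ?_)
  exact NormedSpace.normalize_smul_of_pos (inv_pos.2 (norm_pos_iff.2 (sub_ne_zero.2 hb))) _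

end Radial

section Chart

variable {S E : Type*} [TopologicalSpace S] [TopologicalSpace E]
  {e : OpenPartialHomeomorph S E} {v : S}

lemma tendsto_symm_cocompact [CompactSpace S] (hs : e.source = {v}ᶜ) (ht : e.target = univ) :
    Tendsto e.symm (cocompact E) (𝓝 v) := by
  rw [(nhds_basis_opens v).tendsto_right_iff]
  rintro U ⟨hvU, hU⟩
  have hsub : Uᶜ ⊆ e.source := by
    rw [hs]
    rintro y hy rfl
    exact hy hvU
  have hK : IsCompact (e '' Uᶜ) := hU.isClosed_compl.isCompact.image_of_continuousOn
    (e.continuousOn.mono hsub)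
  filter_upwards [hK.compl_mem_cocompact] with w hw
  by_contra h
  exact hw ⟨e.symm w, h, e.right_inv (by simp [ht])⟩

lemma tendsto_chart_nhdsNE [T2Space S] (hs : e.source = {v}ᶜ) (ht : e.target = univ) :
    Tendsto e (𝓝[≠] v) (cocompact E) := by
  rw [hasBasis_cocompact.tendsto_right_iff]
  intro K hK
  have hK' : IsCompact (e.symm '' K) :=
    hK.image_of_continuousOn (e.continuousOn_symm.mono (by simp [ht]))
  have hv : (e.symm '' K)ᶜ ∈ 𝓝 v := by
    refine hK'.isClosed.isOpen_compl.mem_nhds ?_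
    rintro ⟨w, -, hw⟩
    have : e.symm w ∈ e.source := e.map_target (by simp [ht])
    rw [hs] at this
    exact this hw
  filter_upwards [mem_nhdsWithin_of_mem_nhds hv, self_mem_nhdsWithin] with y hy hyv hyK
  exact hy ⟨e y, hyK, e.left_inv (by rw [hs]; exact hyv)⟩

open Classical in
/-- The extension to `S` of a self-map of `S \ {v}` given in a chart. -/
def extendChart (e : OpenPartialHomeomorph S E) (v : S) (r : E → E) (y : S) : S :=
  if y = v then v else e.symm (r (e y))

lemma continuous_extendChart [CompactSpace S] [T2Space S] (hs : e.source = {v}ᶜ)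
    (ht : e.target = univ) {r : E → E} (hr : Continuous r)
    (hr' : Tendsto r (cocompact E) (cocompact E)) :
    Continuous (extendChart e v r) := by
  have heq : EqOn (extendChart e v r) (fun y => e.symm (r (e y))) {v}ᶜ := fun y hy => if_neg hy
  refine continuous_iff_continuousAt.2 fun y => ?_
  rcases eq_or_ne y v with rfl | hy
  · rw [← continuousWithinAt_compl_self, ContinuousWithinAt, extendChart, if_pos rfl]
    refine Tendsto.congr' (heq.eventuallyEq_nhdsWithin).symm ?_
    exact (tendsto_symm_cocompact hs ht).comp (hr'.comp (tendsto_chart_nhdsNE hs ht))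
  · have hy' : y ∈ e.source := by rw [hs]; exact hy
    refine ContinuousAt.congr ?_ (heq.eventuallyEq_of_mem (isOpen_compl_singleton.mem_nhds hy)).symm
    have h1 : ContinuousAt e.symm (r (e y)) := e.continuousAt_symm (by simp [ht])
    exact ContinuousAt.comp (f := fun y => r (e y)) h1 (hr.continuousAt.comp (e.continuousAt hy'))

end Chart

/-- Data replacing every point `x` of `Z` by a closed disk of directions at `x`, seen in the
chart `e`: the projection `proj` collapses the disks, `dir` is the radial coordinate in the disks,
and `lift x ξ` is the point of the disk above `x` with coordinate `ξ`. A point near the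
boundary of the disk above `x` has a projection close to `x` in the corresponding direction. -/
structure RadialBlowup {S E : Type*} [TopologicalSpace S] [NormedAddCommGroup E] [NormedSpace ℝ E]
    (e : OpenPartialHomeomorph S E) (Z : Set S) where
  proj : S → S
  dir : S → E
  lift : S → E → S
  continuous_proj : Continuous proj
  norm_dir_le : ∀ y, ‖dir y‖ ≤ 1
  lift_proj_dir : ∀ y, lift (proj y) (dir y) = y
  proj_lift : ∀ x ξ, ‖ξ‖ ≤ 1 → proj (lift x ξ) = x
  dir_lift : ∀ x ∈ Z, ∀ ξ, ‖ξ‖ ≤ 1 → dir (lift x ξ) = ξ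
  lift_eq_lift : ∀ x ∉ Z, ∀ ξ ξ', lift x ξ = lift x ξ'
  continuous_lift : ∀ x ∈ Z, Continuous (lift x)
  continuousOn_dir : ∀ x ∈ Z, ContinuousOn dir (proj ⁻¹' {x})
  tendsto_dir : ∀ y, proj y ∈ Z →
    Tendsto (fun y' => normalize (e (proj y') - e (proj y))) (𝓝[{y' | proj y' ≠ proj y}] y)
      (𝓝 (dir y))
  tendsto_lift : ∀ x ∈ Z, ∀ (l : Filter S) (X : S → S) (Ξ : S → E) (ξ : E), Tendsto X l (𝓝 x) →
    (∀ᶠ s in l, X s ≠ x) → (∀ s, ‖Ξ s‖ ≤ 1) →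
    Tendsto (fun s => normalize (e (X s) - e x)) l (𝓝 ξ) →
    Tendsto (fun s => lift (X s) (Ξ s)) l (𝓝 (lift x ξ))

section Existence

variable {S E : Type*} [TopologicalSpace S] [CompactSpace S] [T2Space S]
  [NormedAddCommGroup E] [InnerProductSpace ℝ E] [FiniteDimensional ℝ E]
  {e : OpenPartialHomeomorph S E} {v : S} {Z : Set S}

lemma exists_weight {E : Type*} [NormedAddCommGroup E] {Z : Set E} (hZ : Z.Countable) :
    ∃ c : E → ℝ, (∀ p, 0 ≤ c p) ∧ (∀ p ∈ Z, 0 < c p) ∧ (∀ p ∉ Z, c p = 0) ∧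
      Summable c ∧ Summable fun p => c p * ‖p‖ := by
  obtain ⟨ε, hε, _, hsum, -⟩ := hZ.exists_pos_hasSum_le one_pos
  have hs : Summable (Z.indicator ε) := summable_subtype_iff_indicator.1 hsum.summable
  have hi : ∀ p, 0 ≤ Z.indicator ε p := fun p => indicator_nonneg (fun q _ => (hε q).le) p
  have hd : ∀ p : E, 0 < 1 + ‖p‖ := fun p => by positivity
  have h0 : ∀ p, 0 ≤ Z.indicator ε p / (1 + ‖p‖) := fun p => div_nonneg (hi p) (hd p).le
  refine ⟨fun p => Z.indicator ε p / (1 + ‖p‖), h0,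
    fun p hp => ?_, fun p hp => ?_, ?_, ?_⟩
  · simpa [hp] using div_pos (hε p) (hd p)
  · simp [hp]
  · refine Summable.of_nonneg_of_le h0 (fun p => ?_) hs
    exact div_le_self (hi p) (by linarith [norm_nonneg p])
  · refine Summable.of_nonneg_of_le (fun p => mul_nonneg (h0 p) (norm_nonneg p)) (fun p => ?_) hs
    rw [div_mul_eq_mul_div, div_le_iff₀ (hd p)]
    exact mul_le_mul_of_nonneg_left (by linarith) (hi p)

theorem nonempty_radialBlowup (hs : e.source = {v}ᶜ) (ht : e.target = univ) (hZ : Z.Countable)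
    (hv : v ∉ Z) : Nonempty (RadialBlowup e Z) := by
  classical
  obtain ⟨c, hc0, hcpos, hczero, hc, hc'⟩ := exists_weight (hZ.image e)
  obtain ⟨r, hr, hrmem, hrlim⟩ := exists_resolvent hc0 hc hc'
  have hsymm : ∀ w, e (e.symm w) = w := fun w => e.right_inv (by simp [ht])
  have hleft : ∀ y, y ≠ v → e.symm (e y) = y := fun y hy => e.left_inv (by rw [hs]; exact hy)
  have hsne : ∀ w, e.symm w ≠ v := fun w => by
    have : e.symm w ∈ e.source := e.map_target (by simp [ht])
    rw [hs] at this
    exact this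
  have hscont : Continuous e.symm := by
    have := e.continuousOn_symm
    rwa [ht, continuousOn_univ] at this
  have hecont : ∀ y, y ≠ v → ContinuousAt e y := fun y hy =>
    e.continuousAt (by rw [hs]; exact hy)
  have hinj : ∀ x y, x ≠ v → y ≠ v → e x = e y → x = y := fun x y hx hy h => by
    rw [← hleft x hx, h, hleft y hy]
  have hZv : ∀ x ∈ Z, x ≠ v := fun x hx h => hv (h ▸ hx)
  have hZpos : ∀ x ∈ Z, 0 < c (e x) := fun x hx => hcpos _ (mem_image_of_mem _ hx)
  have hZzero : ∀ x, x ≠ v → x ∉ Z → c (e x) = 0 := fun x hx hxZ => hczero _ (by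
    rintro ⟨x', hx', h⟩
    exact hxZ (hinj x' x (hZv x' hx') hx h ▸ hx'))
  set proj : S → S := extendChart e v r with hproj
  have hproj_v : proj v = v := if_pos rfl
  have hproj_ne : ∀ y, y ≠ v → proj y = e.symm (r (e y)) := fun y hy => if_neg hy
  have hproj_cont : Continuous proj := continuous_extendChart hs ht hr hrlim
  set dir : S → E := fun y =>
    if y = v then 0 else (c (e (proj y)))⁻¹ • (e y - e (proj y) - drift c (e (proj y))) with hdir
  set lift : S → E → S := fun x ξ =>
    if x = v then v else e.symm (e x + drift c (e x) + c (e x) • ξ) with hlift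
  have hlift_ne : ∀ x ξ, x ≠ v → lift x ξ = e.symm (e x + drift c (e x) + c (e x) • ξ) :=
    fun x ξ hx => if_neg hx
  have hdir_ne : ∀ y, y ≠ v →
      dir y = (c (e (proj y)))⁻¹ • (e y - e (proj y) - drift c (e (proj y))) :=
    fun y hy => if_neg hy
  have hmem : ∀ y, y ≠ v → ‖e y - e (proj y) - drift c (e (proj y))‖ ≤ c (e (proj y)) := by
    intro y hy
    rw [← hrmem, hproj_ne y hy, hsymm]
  have hsplit : ∀ y, y ≠ v →
      e y = e (proj y) + drift c (e (proj y)) + c (e (proj y)) • dir y := by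
    intro y hy
    rw [hdir_ne y hy]
    rcases (hc0 (e (proj y))).eq_or_lt with h | h
    · have := hmem y hy
      rw [← h, norm_le_zero_iff, sub_sub, sub_eq_zero] at this
      simp [← h, ← this]
    · rw [smul_inv_smul₀ h.ne']
      abel
  have hnorm : ∀ y, ‖dir y‖ ≤ 1 := by
    intro y
    rcases eq_or_ne y v with rfl | hy
    · simp [hdir]
    · rw [hdir_ne y hy, norm_smul, norm_inv, Real.norm_of_nonneg (hc0 _), inv_mul_eq_div]
      exact div_le_one_of_le₀ (hmem y hy) (hc0 _)
  have hproj_ne_v : ∀ y, y ≠ v → proj y ≠ v := fun y hy => by rw [hproj_ne y hy]; exact hsne _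
  have hne_of_proj : ∀ y, proj y ∈ Z → y ≠ v := by
    rintro y hy rfl
    exact hv (hproj_v ▸ hy)
  have hproj_lift : ∀ x ξ, ‖ξ‖ ≤ 1 → proj (lift x ξ) = x := by
    intro x ξ hξ
    rcases eq_or_ne x v with rfl | hx
    · simp [hlift, hproj_v]
    · rw [hlift_ne x ξ hx, hproj_ne _ (hsne _), hsymm]
      have : r (e x + drift c (e x) + c (e x) • ξ) = e x := by
        rw [hrmem, add_sub_right_comm, add_sub_cancel_left, add_sub_cancel_left, norm_smul,
          Real.norm_of_nonneg (hc0 _)]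
        exact mul_le_of_le_one_right (hc0 _) hξ
      rw [this, hleft x hx]
  refine ⟨⟨proj, dir, lift, hproj_cont, hnorm, ?_, hproj_lift, ?_, ?_, ?_, ?_, ?_, ?_⟩⟩
  · intro y
    rcases eq_or_ne y v with rfl | hy
    · simp [hlift, hproj_v]
    · rw [hlift_ne _ _ (hproj_ne_v y hy), ← hsplit y hy, hleft y hy]
  · intro x hx ξ hξ
    have hlv : lift x ξ ≠ v := by rw [hlift_ne x ξ (hZv x hx)]; exact hsne _
    rw [hdir_ne _ hlv, hproj_lift x ξ hξ, hlift_ne x ξ (hZv x hx), hsymm, add_sub_right_comm,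
      add_sub_cancel_left, add_sub_cancel_left, inv_smul_smul₀ (hZpos x hx).ne']
  · intro x hx ξ ξ'
    rcases eq_or_ne x v with rfl | hxv
    · simp [hlift]
    · rw [hlift_ne _ _ hxv, hlift_ne _ _ hxv, hZzero x hxv hx, zero_smul, zero_smul]
  · intro x hx
    have : lift x = fun ξ => e.symm (e x + drift c (e x) + c (e x) • ξ) :=
      funext fun ξ => hlift_ne x ξ (hZv x hx)
    rw [this]
    exact hscont.comp (by fun_prop)
  · intro x hx
    have heq : EqOn dir (fun y => (c (e x))⁻¹ • (e y - e x - drift c (e x))) (proj ⁻¹' {x}) := by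
      rintro y rfl
      exact hdir_ne y (hne_of_proj y hx)
    refine ContinuousOn.congr (fun y hy => ContinuousAt.continuousWithinAt ?_) heq
    have := hecont y (hne_of_proj y (by rw [show proj y = x from hy]; exact hx))
    fun_prop
  · intro y hy
    have hyv := hne_of_proj y hy
    have hpv := hproj_ne_v y hyv
    have hpos := hZpos _ hy
    have hle : 𝓝[{y' | proj y' ≠ proj y}] y ≤ 𝓝 y := nhdsWithin_le_nhds
    have hev : ∀ᶠ y' in 𝓝[{y' | proj y' ≠ proj y}] y, y' ≠ v := hle (isOpen_ne.mem_nhds hyv)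
    have hE : Tendsto e (𝓝[{y' | proj y' ≠ proj y}] y) (𝓝 (e y)) := (hecont y hyv).mono_left hle
    have hX : Tendsto (fun y' => e (proj y')) (𝓝[{y' | proj y' ≠ proj y}] y) (𝓝 (e (proj y))) :=
      (hecont _ hpv).tendsto.comp (hproj_cont.continuousAt.mono_left hle)
    have hX' : Tendsto (fun y' => e (proj y')) (𝓝[{y' | proj y' ≠ proj y}] y)
        (𝓝[≠] (e (proj y))) := by
      refine tendsto_nhdsWithin_iff.2 ⟨hX, ?_⟩
      filter_upwards [self_mem_nhdsWithin, hev] with y' h1 h2 h3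
      exact h1 (hinj _ _ (hproj_ne_v y' h2) hpv h3)
    have hrem : Tendsto (fun y' => c (e (proj y')) • dir y') (𝓝[{y' | proj y' ≠ proj y}] y)
        (𝓝 0) := by
      refine squeeze_zero_norm (fun y' => ?_) ((tendsto_weight_nhdsNE hc _).comp hX')
      rw [norm_smul, Real.norm_of_nonneg (hc0 _)]
      exact mul_le_of_le_one_right (hc0 _) (hnorm y')
    have hlim := ((((hE.sub hX).sub ((tendsto_drift_sub_jump hc0 hc (e (proj y))).comp hX)).sub
      hrem).const_smul (c (e (proj y)))⁻¹)
    rw [sub_zero, ← hdir_ne y hyv] at hlim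
    refine hlim.congr' (hev.mono fun y' hy' => ?_)
    simp only [Function.comp_apply]
    nth_rewrite 1 [hsplit y' hy']
    rw [inv_smul_eq_iff₀ hpos.ne']
    abel
  · intro x hx l X Ξ ξ hXx hXne hΞ hξ
    have hxv := hZv x hx
    have hev : ∀ᶠ s in l, X s ≠ v := hXx (isOpen_ne.mem_nhds hxv)
    have hE : Tendsto (fun s => e (X s)) l (𝓝 (e x)) := (hecont x hxv).tendsto.comp hXx
    have hE' : Tendsto (fun s => e (X s)) l (𝓝[≠] (e x)) := by
      refine tendsto_nhdsWithin_iff.2 ⟨hE, ?_⟩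
      filter_upwards [hXne, hev] with s h1 h2 h3
      exact h1 (hinj _ _ h2 hxv h3)
    have hrem : Tendsto (fun s => c (e (X s)) • Ξ s) l (𝓝 0) := by
      refine squeeze_zero_norm (fun s => ?_) ((tendsto_weight_nhdsNE hc _).comp hE')
      rw [norm_smul, Real.norm_of_nonneg (hc0 _)]
      exact mul_le_of_le_one_right (hc0 _) (hΞ s)
    have hlim := ((hE.add ((tendsto_drift_sub_jump hc0 hc (e x)).comp hE)).add
      (hξ.const_smul (c (e x)))).add hrem
    rw [add_zero] at hlim
    have hlim' := (hscont.tendsto _).comp hlim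
    rw [← hlift_ne x ξ hxv] at hlim'
    refine hlim'.congr' (hev.mono fun s hs' => ?_)
    simp only [Function.comp_apply]
    rw [hlift_ne _ _ hs']
    congr 1
    abel

end Existence

namespace RadialBlowup

variable {S E : Type*} [TopologicalSpace S] [NormedAddCommGroup E] [NormedSpace ℝ E]
  {e : OpenPartialHomeomorph S E} {Z : Set S} (B : RadialBlowup e Z)

lemma proj_surjective : Function.Surjective B.proj :=
  fun x => ⟨B.lift x 0, B.proj_lift x 0 (by simp)⟩

lemma lift_dir_of_proj_eq {x y : S} (h : B.proj y = x) : B.lift x (B.dir y) = y := by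
  rw [← h, B.lift_proj_dir]

lemma eq_of_proj_eq {y y' : S} (h : B.proj y = B.proj y') (hy : B.proj y ∉ Z) : y = y' := by
  rw [← B.lift_proj_dir y, ← B.lift_proj_dir y', ← h]
  exact B.lift_eq_lift _ hy _ _

/-- The fibre above a point of `Z` is a closed disk. -/
def fibreHomeomorph {x : S} (hx : x ∈ Z) : ↥(B.proj ⁻¹' {x}) ≃ₜ ↥(closedBall (0 : E) 1) where
  toFun y := ⟨B.dir y, mem_closedBall_zero_iff.2 (B.norm_dir_le y)⟩
  invFun ξ := ⟨B.lift x ξ, B.proj_lift x ξ (mem_closedBall_zero_iff.1 ξ.2)⟩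
  left_inv y := Subtype.ext (B.lift_dir_of_proj_eq y.2)
  right_inv ξ := Subtype.ext (B.dir_lift x hx ξ (mem_closedBall_zero_iff.1 ξ.2))
  continuous_toFun :=
    (continuousOn_iff_continuous_domRestrict.1 (B.continuousOn_dir x hx)).subtype_mk _
  continuous_invFun := ((B.continuous_lift x hx).comp continuous_subtype_val).subtype_mk _

/-- The lift to the blow-up of a self-map `f` of `S` with derivative `A x` at `x`. -/
def map (f : S → S) (A : S → E →L[ℝ] E) (y : S) : S :=
  B.lift (f (B.proj y)) (radial (A (B.proj y)) (B.dir y))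

lemma norm_radial_dir_le (A : E →L[ℝ] E) (y : S) : ‖radial A (B.dir y)‖ ≤ 1 :=
  (norm_radial_le _ _).trans (B.norm_dir_le y)

lemma proj_map (f : S → S) (A : S → E →L[ℝ] E) (y : S) :
    B.proj (B.map f A y) = f (B.proj y) :=
  B.proj_lift _ _ (B.norm_radial_dir_le _ y)

lemma map_id {A : S → E →L[ℝ] E} (hA : ∀ x ∈ Z, A x = ContinuousLinearMap.id ℝ E) (y : S) :
    B.map id A y = y := by
  by_cases hy : B.proj y ∈ Z
  · rw [map, hA _ hy, radial_id, id, B.lift_proj_dir]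
  · exact (B.eq_of_proj_eq (B.proj_map id A y).symm hy).symm

lemma map_comp {f g : S → S} {A A' A'' : S → E →L[ℝ] E} (hg : MapsTo g Z Z)
    (hfg : ∀ x ∉ Z, f (g x) ∉ Z)
    (hA' : ∀ x ∈ Z, Function.Injective (A' x))
    (hA'' : ∀ x ∈ Z, A'' x = (A (g x)).comp (A' x)) (y : S) :
    B.map (f ∘ g) A'' y = B.map f A (B.map g A' y) := by
  by_cases hy : B.proj y ∈ Z
  · rw [map, map, B.proj_map, hA'' _ hy, radial_comp _ (hA' _ hy), map,
      B.dir_lift _ (hg hy) _ (B.norm_radial_dir_le _ y), Function.comp_apply]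
  · refine B.eq_of_proj_eq ?_ ?_
    · simp only [B.proj_map, Function.comp_apply]
    · rw [B.proj_map]
      exact hfg _ hy

lemma continuous_map [CompactSpace S] [T2Space S] {f : S → S} {A : S → E →L[ℝ] E}
    (hf : Continuous f) (hinj : Function.Injective f) (hZ : ∀ x, f x ∈ Z ↔ x ∈ Z)
    (hsrc : Z ⊆ e.source)
    (hfA : ∀ x ∈ Z, HasFDerivAt (fun w => e (f (e.symm w))) (A x) (e x))
    (hA : ∀ x ∈ Z, Function.Injective (A x)) : Continuous (B.map f A) := by
  refine continuous_iff_continuousAt.2 fun y => ?_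
  have hpf : Continuous fun y => f (B.proj y) := hf.comp B.continuous_proj
  by_cases hy : B.proj y ∈ Z
  · have hAy := hA _ hy
    have hfy : f (B.proj y) ∈ Z := (hZ _).2 hy
    have hfib : ContinuousWithinAt (B.map f A) (B.proj ⁻¹' {B.proj y}) y := by
      have h1 : ContinuousOn (fun y' => B.lift (f (B.proj y)) (radial (A (B.proj y)) (B.dir y')))
          (B.proj ⁻¹' {B.proj y}) :=
        ((B.continuous_lift _ hfy).comp (continuous_radial hAy)).comp_continuousOn
          (B.continuousOn_dir _ hy)
      refine (h1.congr fun y' hy' => ?_) y rfl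
      rw [map, show B.proj y' = B.proj y from hy']
    have hout : ContinuousWithinAt (B.map f A) {y' | B.proj y' ≠ B.proj y} y := by
      rcases eq_or_neBot (𝓝[{y' | B.proj y' ≠ B.proj y}] y) with hbot | hne
      · rw [ContinuousWithinAt, hbot]
        exact tendsto_bot
      set l := 𝓝[{y' | B.proj y' ≠ B.proj y}] y with hl
      have hle : l ≤ 𝓝 y := nhdsWithin_le_nhds
      have hproj : Tendsto B.proj l (𝓝 (B.proj y)) := B.continuous_proj.continuousAt.mono_left hle
      have hmem : ∀ᶠ y' in l, B.proj y' ≠ B.proj y := self_mem_nhdsWithin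
      have hsrcev : ∀ᶠ y' in l, B.proj y' ∈ e.source :=
        hproj (e.open_source.mem_nhds (hsrc hy))
      have hchart : Tendsto (fun y' => e (B.proj y')) l (𝓝 (e (B.proj y))) :=
        (e.continuousAt (hsrc hy)).tendsto.comp hproj
      have hchart_ne : ∀ᶠ y' in l, e (B.proj y') ≠ e (B.proj y) := by
        filter_upwards [hmem, hsrcev] with y' h1 h2 h3
        exact h1 (e.injOn h2 (hsrc hy) h3)
      have hdir := B.tendsto_dir y hy
      have hnorm : ‖B.dir y‖ = 1 := by
        refine tendsto_nhds_unique hdir.norm (tendsto_const_nhds.congr' ?_)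
        filter_upwards [hchart_ne] with y' h
        exact (NormedSpace.norm_normalize (sub_ne_zero.2 h)).symm
      have hne0 : A (B.proj y) (B.dir y) ≠ 0 := fun h => by
        have : B.dir y = 0 := hAy (by rw [h, map_zero])
        simp [this] at hnorm
      have hfd := (hfA _ hy).tendsto_normalize_sub hchart hchart_ne hdir hne0
      have hrad : radial (A (B.proj y)) (B.dir y) = normalize (A (B.proj y) (B.dir y)) := by
        rw [radial, hnorm, one_smul]
      have := B.tendsto_lift _ hfy l (fun y' => f (B.proj y'))
        (fun y' => radial (A (B.proj y')) (B.dir y')) (normalize (A (B.proj y) (B.dir y)))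
        (hpf.continuousAt.mono_left hle) (hmem.mono fun y' h h' => h (hinj h'))
        (fun y' => B.norm_radial_dir_le _ y') (hfd.congr' ?_)
      · rwa [← hrad] at this
      · filter_upwards [hsrcev] with y' h
        rw [e.left_inv h, e.left_inv (hsrc hy)]
    have := hfib.union hout
    rwa [show B.proj ⁻¹' {B.proj y} ∪ {y' | B.proj y' ≠ B.proj y} = univ by
      ext; simp [em], continuousWithinAt_univ] at this
  · refine tendsto_nhds_of_unique_mapClusterPt fun a ha => ?_
    have h1 : MapClusterPt (B.proj a) (𝓝 y) (B.proj ∘ B.map f A) :=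
      ha.continuousAt_comp B.continuous_proj.continuousAt
    have h2 : Tendsto (B.proj ∘ B.map f A) (𝓝 y) (𝓝 (f (B.proj y))) := by
      have : B.proj ∘ B.map f A = fun y => f (B.proj y) := funext (B.proj_map f A)
      rw [this]
      exact hpf.continuousAt
    have h3 : B.proj a = f (B.proj y) :=
      have := h1.neBot
      eq_of_nhds_neBot (h1.neBot.mono (inf_le_inf_left _ h2))
    refine B.eq_of_proj_eq (by rw [h3, B.proj_map]) ?_
    rw [h3, hZ]
    exact hy

end RadialBlowup

/-- An action on a compact space `S` which is differentiable, in the chart `e`, at every point of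
a countable invariant set `Z` can be blown up along `Z`. -/
theorem exists_blowup {S E Γ : Type*} [TopologicalSpace S] [CompactSpace S] [T2Space S]
    [NormedAddCommGroup E] [InnerProductSpace ℝ E] [FiniteDimensional ℝ E] [Group Γ]
    {e : OpenPartialHomeomorph S E} {v : S} {Z : Set S} (hs : e.source = {v}ᶜ)
    (ht : e.target = univ) (hZ : Z.Countable) (hv : v ∉ Z) {ρ : Γ → C(S, S)} (hρ : IsRep ρ)
    (hinv : ∀ γ, MapsTo (ρ γ) Z Z)
    (hdiff : ∀ γ, ∀ x ∈ Z, DifferentiableAt ℝ (fun w => e (ρ γ (e.symm w))) (e x)) :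
    ∃ ρ' : Γ → C(S, S), IsRep ρ' ∧ ∃ h : S → S, Continuous h ∧ Function.Surjective h ∧
      (∀ p ∈ Z, Nonempty (↥(h ⁻¹' {p}) ≃ₜ ↥(closedBall (0 : E) 1))) ∧
      InjOn h (h ⁻¹' Z)ᶜ ∧ ∀ γ x, h (ρ' γ x) = ρ γ (h x) := by
  obtain ⟨B⟩ := nonempty_radialBlowup hs ht hZ hv
  have hsrc : Z ⊆ e.source := fun x hx => by
    rw [hs]
    rintro rfl
    exact hv hx
  have hone : ∀ x, ρ 1 x = x := fun x => by rw [hρ.1, ContinuousMap.id_apply]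
  have hmul : ∀ a b x, ρ (a * b) x = ρ a (ρ b x) := fun a b x => by
    rw [hρ.2, ContinuousMap.comp_apply]
  have hinvl : ∀ γ x, ρ γ⁻¹ (ρ γ x) = x := fun γ x => by rw [← hmul, inv_mul_cancel, hone]
  have hiff : ∀ γ x, ρ γ x ∈ Z ↔ x ∈ Z := fun γ x =>
    ⟨fun h => hinvl γ x ▸ hinv γ⁻¹ h, fun h => hinv γ h⟩
  set A : Γ → S → E →L[ℝ] E := fun γ x => fderiv ℝ (fun w => e (ρ γ (e.symm w))) (e x)
  have hA : ∀ γ, ∀ x ∈ Z, HasFDerivAt (fun w => e (ρ γ (e.symm w))) (A γ x) (e x) :=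
    fun γ x hx => (hdiff γ x hx).hasFDerivAt
  have hAone : ∀ x ∈ Z, A 1 x = ContinuousLinearMap.id ℝ E := by
    intro x hx
    have : (fun w => e (ρ 1 (e.symm w))) = id := funext fun w => by
      rw [hone, e.right_inv (by simp [ht]), id]
    simp only [A, this, fderiv_id]
  have hAmul : ∀ a b, ∀ x ∈ Z, A (a * b) x = (A a (ρ b x)).comp (A b x) := by
    intro a b x hx
    have hxs : e.symm (e x) = x := e.left_inv (hsrc hx)
    have h1 : HasFDerivAt (fun w => e (ρ a (e.symm w))) (A a (ρ b x)) (e (ρ b (e.symm (e x)))) := by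
      rw [hxs]
      exact hA a _ (hinv b hx)
    refine HasFDerivAt.unique (hA (a * b) x hx)
      ((h1.comp (e x) (hA b x hx)).congr_of_eventuallyEq ?_)
    have hcont : ContinuousAt (fun w => ρ b (e.symm w)) (e x) :=
      (ρ b).continuous.continuousAt.comp (e.continuousAt_symm (by simp [ht]))
    have hev : ∀ᶠ w in 𝓝 (e x), ρ b (e.symm w) ∈ e.source :=
      hcont (e.open_source.mem_nhds (hsrc (by simpa only [hxs] using hinv b hx)))
    filter_upwards [hev] with w hw
    rw [Function.comp_apply, e.left_inv hw, hmul]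
  have hAinj : ∀ γ, ∀ x ∈ Z, Function.Injective (A γ x) := by
    intro γ x hx ξ ξ' h
    have h1 := hAmul γ⁻¹ γ x hx
    rw [inv_mul_cancel, hAone x hx] at h1
    have h2 : ∀ η, A γ⁻¹ (ρ γ x) (A γ x η) = η := fun η =>
      (congrArg (fun L : E →L[ℝ] E => L η) h1).symm
    rw [← h2 ξ, h, h2]
  refine ⟨fun γ => ⟨B.map (ρ γ) (A γ), B.continuous_map (ρ γ).continuous
    (Function.LeftInverse.injective (hinvl γ)) (hiff γ) hsrc (hA γ) (hAinj γ)⟩, ⟨?_, ?_⟩,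
    B.proj, B.continuous_proj, B.proj_surjective, fun p hp => ⟨B.fibreHomeomorph hp⟩, ?_, ?_⟩
  · ext1 y
    have : (ρ 1 : S → S) = id := funext hone
    simpa [this] using B.map_id hAone y
  · intro a b
    ext1 y
    have : (ρ (a * b) : S → S) = ρ a ∘ ρ b := funext (hmul a b)
    simpa [this] using B.map_comp (hinv b) (fun x hx => by rwa [hiff, hiff]) (hAinj b)
      (hAmul a b) y
  · intro y hy y' _ h
    exact B.eq_of_proj_eq h hy
  · exact fun γ y => B.proj_map _ _ y

lemma Sph.exists_notMem_of_countable {n : ℕ} (hn : n ≠ 0) {Z : Set (Sph n)} (hZ : Z.Countable) :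
    ∃ v, v ∉ Z := by
  by_contra! h
  have : Nonempty (Fin n) := ⟨⟨0, Nat.pos_of_ne_zero hn⟩⟩
  obtain ⟨p⟩ : Nonempty (Sph n) :=
    (NormedSpace.sphere_nonempty.2 zero_le_one).to_subtype
  have : Fact (Module.finrank ℝ (EuclideanSpace ℝ (Fin (n + 1))) = n + 1) := ⟨by simp⟩
  have hcount : (stereographic' n p '' Z).Countable := hZ.image _
  obtain ⟨w, hw⟩ := (hcount.dense_compl ℝ).nonempty
  exact hw ⟨(stereographic' n p).symm w, h _, (stereographic' n p).right_inv (by simp)⟩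

lemma Sph.differentiableAt_chart {n : ℕ} {f : Sph n → Sph n} (hf : ContMDiff (𝓡 n) (𝓡 n) 1 f)
    {e : OpenPartialHomeomorph (Sph n) (EuclideanSpace ℝ (Fin n))}
    (he : e ∈ IsManifold.maximalAtlas (𝓡 n) 1 (Sph n)) {x : Sph n} (hx : x ∈ e.source)
    (hfx : f x ∈ e.source) : DifferentiableAt ℝ (fun w => e (f (e.symm w))) (e x) := by
  have h1 : ContMDiffAt (𝓡 n) (𝓡 n) 1 e.symm (e x) :=
    (contMDiffOn_symm_of_mem_maximalAtlas he).contMDiffAt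
      (e.open_target.mem_nhds (e.map_source hx))
  have h2 : ContMDiffAt (𝓡 n) (𝓡 n) 1 e (f (e.symm (e x))) := by
    rw [e.left_inv hx]
    exact (contMDiffOn_of_mem_maximalAtlas he).contMDiffAt (e.open_source.mem_nhds hfx)
  have h3 : ContMDiffAt (𝓡 n) (𝓡 n) 1 (fun w => e (f (e.symm w))) (e x) :=
    ContMDiffAt.comp (e x) h2 (hf.contMDiffAt.comp (e x) h1)
  exact (contMDiffAt_iff_contDiffAt.1 h3).differentiableAt one_ne_zero

/-- **Equivariant blow-up of a dense orbit** (Proposition 4.1). -/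
theorem blowup_of_dense_orbit
    (n : ℕ) (Γ : Type) [Group Γ] [Countable Γ]
    (ρ : Γ → C(Sph n, Sph n)) (hρ : IsRep ρ)
    (hC1 : ∀ γ : Γ, ContMDiff (𝓡 n) (𝓡 n) 1 (ρ γ))
    (z : Sph n) (hdense : Dense (Set.range fun γ : Γ => ρ γ z)) :
    ∃ ρ' : Γ → C(Sph n, Sph n), IsRep ρ' ∧
      ∃ h : Sph n → Sph n, Continuous h ∧ Function.Surjective h ∧
        (∀ p ∈ Set.range (fun γ : Γ => ρ γ z),
          Nonempty (↥(h ⁻¹' {p}) ≃ₜ Disk n)) ∧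
        Set.InjOn h ((h ⁻¹' (Set.range fun γ : Γ => ρ γ z))ᶜ) ∧
        ∀ (γ : Γ) (x : Sph n), h (ρ' γ x) = ρ γ (h x) := by
  rcases eq_or_ne n 0 with rfl | hn
  · refine ⟨ρ, hρ, id, continuous_id, Function.surjective_id, fun p _ => ?_, injOn_id _,
      fun _ _ => rfl⟩
    have : Unique (Disk 0) :=
      ⟨⟨⟨0, by simp⟩⟩, fun w => Subtype.ext (Subsingleton.elim _ _)⟩
    have : Unique ↥((id : Sph 0 → Sph 0) ⁻¹' {p}) := inferInstanceAs (Unique ↥({p} : Set (Sph 0)))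
    exact ⟨Homeomorph.homeomorphOfUnique _ _⟩
  · have hZ : (range fun γ : Γ => ρ γ z).Countable := countable_range _
    obtain ⟨v, hv⟩ := Sph.exists_notMem_of_countable hn hZ
    have hinv : ∀ γ, MapsTo (ρ γ) (range fun γ : Γ => ρ γ z) (range fun γ : Γ => ρ γ z) := by
      rintro γ _ ⟨γ', rfl⟩
      exact ⟨γ * γ', by simp [hρ.2]⟩
    have : Fact (Module.finrank ℝ (EuclideanSpace ℝ (Fin (n + 1))) = n + 1) := ⟨by simp⟩
    have hs : (stereographic' n v).source = {v}ᶜ := stereographic'_source v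
    have hsrc : (range fun γ : Γ => ρ γ z) ⊆ (stereographic' n v).source := by
      rw [hs]
      rintro x hx rfl
      exact hv hx
    exact exists_blowup hs (stereographic'_target v) hZ hv hρ hinv fun γ x hx =>
      Sph.differentiableAt_chart (hC1 γ)
        (IsManifold.subset_maximalAtlas ⟨v, rfl⟩) (hsrc hx) (hsrc (hinv γ hx))

end
end
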